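/- Let (x₁*, …, xₙ*) with 0 < x₁* < ⋯ < xₙ* be the unique global minimizer of the Wilson Morse function W and set Rₙ = xₙ*. Let x : [0,∞) → ℝⁿ be a differentiable solution of the gradient system dx_j/dt = −∂W/∂x_j (j = 1,…,n) with arbitrary initial condition x(0) ∈ ℝⁿ, and fix any κ with 0 < κ < 2(n − 1)/(1 + 4Rₙ²) + Σ_{ε∈{a,b,c,d}} Re(ε)/(Re(ε)² + (Rₙ + |Im(ε)|)²). Then there exists a constant K > 0 such that |x_j(t) − x_j*| ≤ K·e^{−κt} for all j = 1,…,n and all t ≥ 0. -/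

import Mathlib

/-- `g_a(θ) = (1/2)(arctan((θ+Im a)/Re a) + arctan((θ−Im a)/Re a))`. -/
noncomputable def gfun (a : ℂ) (θ : ℝ) : ℝ :=
  (Real.arctan ((θ + a.im) / a.re) + Real.arctan ((θ - a.im) / a.re)) / 2

/-- `G_a(s) = ∫₀ˢ g_a(θ) dθ`. -/
noncomputable def Gfun (a : ℂ) (s : ℝ) : ℝ := ∫ θ in (0:ℝ)..s, gfun a θ

/-- `F(s) = ∫₀ˢ arctan(θ) dθ`. -/
noncomputable def Ffun (s : ℝ) : ℝ := ∫ θ in (0:ℝ)..s, Real.arctan θ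

/-- The Wilson Morse function
`W(x) = Σ_{j<k} (F(x_j + x_k) + F(x_j − x_k))
        + Σ_j (G_a(x_j) + G_b(x_j) + G_c(x_j) + G_d(x_j) − π·j·x_j)`,
with `j, k` running through `1, …, n` (so a Lean index `j : Fin n` corresponds to `j+1`). -/
noncomputable def W (n : ℕ) (a b c d : ℂ) (x : Fin n → ℝ) : ℝ :=
  (∑ j : Fin n, ∑ k : Fin n, if j < k then Ffun (x j + x k) + Ffun (x j - x k) else 0)
  + ∑ j : Fin n, (Gfun a (x j) + Gfun b (x j) + Gfun c (x j) + Gfun d (x j)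
      - Real.pi * (((j : ℕ) : ℝ) + 1) * x j)

/-- Non-real parameters among `{a,b,c,d}` occur in complex-conjugate pairs, i.e. the
multiset `{a,b,c,d}` is invariant under complex conjugation. -/
def QuadCond (a b c d : ℂ) : Prop :=
  Multiset.map (starRingEnd ℂ) {a, b, c, d} = ({a, b, c, d} : Multiset ℂ)

theorem mul_sub_arctan_div_ge {r M p q : ℝ} (hr : 0 < r) (hp : |p| ≤ M) (hq : |q| ≤ M) :
    (p - q) ^ 2 * (r / (r ^ 2 + M ^ 2)) ≤
      (p - q) * (Real.arctan (p / r) - Real.arctan (q / r)) := by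
  have key : ∀ p q : ℝ, |p| ≤ M → |q| ≤ M → q ≤ p →
      (r / (r ^ 2 + M ^ 2)) * (p - q) ≤ Real.arctan (p / r) - Real.arctan (q / r) := by
    intro p q hp hq hqp
    have hderiv : ∀ y : ℝ, HasDerivAt (fun y => Real.arctan (y / r))
        (1 / (1 + (y / r) ^ 2) * (1 / r)) y := fun y =>
      ((hasDerivAt_id y).div_const r).arctan
    refine (convex_Icc (-M) M).mul_sub_le_image_sub_of_le_deriv
      (f := fun y => Real.arctan (y / r)) (fun y _ => (hderiv y).continuousAt.continuousWithinAt)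
      (fun y _ => (hderiv y).differentiableAt.differentiableWithinAt) ?_
      q (abs_le.mp hq) p (abs_le.mp hp) hqp
    intro y hy
    rw [(hderiv y).deriv]
    have hyM : y ^ 2 ≤ M ^ 2 := by
      have := interior_subset hy
      exact sq_le_sq' this.1 this.2
    have heq : 1 / (1 + (y / r) ^ 2) * (1 / r) = r / (r ^ 2 + y ^ 2) := by
      have : 0 < r ^ 2 + y ^ 2 := by positivity
      field_simp
    rw [heq]
    gcongr
  rcases le_total q p with h | h
  · nlinarith [key p q hp hq h]
  · nlinarith [key q p hq hp h]

theorem mul_sub_arctan_ge {M p q : ℝ} (hp : |p| ≤ M) (hq : |q| ≤ M) :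
    (p - q) ^ 2 * (1 / (1 + M ^ 2)) ≤ (p - q) * (Real.arctan p - Real.arctan q) := by
  simpa using mul_sub_arctan_div_ge one_pos hp hq

theorem mul_sub_gfun_ge {a : ℂ} (ha : 0 < a.re) {M p q : ℝ} (hp : |p| ≤ M) (hq : |q| ≤ M) :
    (p - q) ^ 2 * (a.re / (a.re ^ 2 + (M + |a.im|) ^ 2)) ≤ (p - q) * (gfun a p - gfun a q) := by
  have h₁ := mul_sub_arctan_div_ge (M := M + |a.im|) ha
    ((abs_add_le p a.im).trans (by gcongr)) ((abs_add_le q a.im).trans (by gcongr))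
  have h₂ := mul_sub_arctan_div_ge (M := M + |a.im|) ha
    ((abs_sub p a.im).trans (by gcongr)) ((abs_sub q a.im).trans (by gcongr))
  rw [add_sub_add_right_eq_sub] at h₁
  rw [sub_sub_sub_cancel_right] at h₂
  unfold gfun
  linarith

theorem continuous_gfun (a : ℂ) : Continuous (gfun a) := by
  unfold gfun
  fun_prop

theorem hasDerivAt_Gfun (a : ℂ) (s : ℝ) : HasDerivAt (Gfun a) (gfun a s) s :=
  ((continuous_gfun a).integral_hasStrictDerivAt 0 s).hasDerivAt

theorem hasDerivAt_Ffun (s : ℝ) : HasDerivAt Ffun (Real.arctan s) s :=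
  (Real.continuous_arctan.integral_hasStrictDerivAt 0 s).hasDerivAt

/-- Sum over ordered pairs of distinct indices, grouped into unordered pairs. -/
theorem sum_lt_add_swap_eq_sum_erase {n : ℕ} (f : Fin n → Fin n → ℝ) :
    (∑ j, ∑ k, if j < k then f j k + f k j else 0) = ∑ j, ∑ k ∈ Finset.univ.erase j, f j k := by
  have h₁ : (∑ j, ∑ k, if j < k then f j k + f k j else 0) =
      (∑ j, ∑ k, if j < k then f j k else 0) + ∑ j, ∑ k, if k < j then f j k else 0 := by
    rw [Finset.sum_comm (f := fun j k => if k < j then f j k else 0), ← Finset.sum_add_distrib]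
    refine Finset.sum_congr rfl fun j _ => ?_
    rw [← Finset.sum_add_distrib]
    refine Finset.sum_congr rfl fun k _ => ?_
    split_ifs <;> simp
  rw [h₁, ← Finset.sum_add_distrib]
  refine Finset.sum_congr rfl fun j _ => ?_
  rw [← Finset.sum_add_distrib, ← Finset.filter_ne' Finset.univ j, Finset.sum_filter]
  refine Finset.sum_congr rfl fun k _ => ?_
  rcases lt_trichotomy j k with h | h | h
  · simp [h, h.ne', h.not_gt]
  · simp [h]
  · simp [h, h.ne, h.not_gt]

/-- The partial derivative `∂W/∂x_j`. -/
noncomputable def wilsonGrad (n : ℕ) (a b c d : ℂ) (x : Fin n → ℝ) (j : Fin n) : ℝ :=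
  -(Real.pi * (((j : ℕ) : ℝ) + 1))
    + gfun a (x j) + gfun b (x j) + gfun c (x j) + gfun d (x j)
    + ∑ k ∈ Finset.univ.erase j, (Real.arctan (x j + x k) + Real.arctan (x j - x k))

theorem sum_mul_wilsonGrad (n : ℕ) (a b c d : ℂ) (x u : Fin n → ℝ) :
    ∑ j, u j * wilsonGrad n a b c d x j =
      (∑ j, ∑ k, if j < k then
        Real.arctan (x j + x k) * (u j + u k) + Real.arctan (x j - x k) * (u j - u k) else 0)
      + ∑ j, (gfun a (x j) * u j + gfun b (x j) * u j + gfun c (x j) * u j + gfun d (x j) * u j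
        - Real.pi * (((j : ℕ) : ℝ) + 1) * u j) := by
  have h := sum_lt_add_swap_eq_sum_erase
    fun j k => u j * (Real.arctan (x j + x k) + Real.arctan (x j - x k))
  have h' : ∀ j k, u j * (Real.arctan (x j + x k) + Real.arctan (x j - x k)) +
      u k * (Real.arctan (x k + x j) + Real.arctan (x k - x j)) =
      Real.arctan (x j + x k) * (u j + u k) + Real.arctan (x j - x k) * (u j - u k) := by
    intro j k
    rw [add_comm (x k), ← neg_sub (x j) (x k), Real.arctan_neg]
    ring
  simp only [h'] at h
  rw [h, ← Finset.sum_add_distrib]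
  refine Finset.sum_congr rfl fun j _ => ?_
  rw [wilsonGrad, ← Finset.mul_sum]
  ring

theorem hasDerivAt_W_line (n : ℕ) (a b c d : ℂ) (x u : Fin n → ℝ) :
    HasDerivAt (fun s : ℝ => W n a b c d (fun j => x j + s * u j))
      (∑ j, u j * wilsonGrad n a b c d x j) 0 := by
  rw [sum_mul_wilsonGrad]
  have hline : ∀ j, HasDerivAt (fun s : ℝ => x j + s * u j) (u j) 0 := fun j => by
    simpa using ((hasDerivAt_id (0 : ℝ)).mul_const (u j)).const_add (x j)
  have hG : ∀ (e : ℂ) (j : Fin n),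
      HasDerivAt (fun s : ℝ => Gfun e (x j + s * u j)) (gfun e (x j) * u j) 0 := fun e j =>
    HasDerivAt.comp (h₂ := Gfun e) 0 (by simpa using hasDerivAt_Gfun e (x j)) (hline j)
  unfold W
  refine HasDerivAt.add (HasDerivAt.fun_sum fun j _ => HasDerivAt.fun_sum fun k _ => ?_)
    (HasDerivAt.fun_sum fun j _ =>
      ((((hG a j).add (hG b j)).add (hG c j)).add (hG d j)).sub ((hline j).const_mul _))
  split_ifs
  · refine HasDerivAt.add
      (HasDerivAt.comp (h₂ := Ffun) 0 ?_ ((hline j).add (hline k)))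
      (HasDerivAt.comp (h₂ := Ffun) 0 ?_ ((hline j).sub (hline k)))
    · simpa using hasDerivAt_Ffun (x j + x k)
    · simpa using hasDerivAt_Ffun (x j - x k)
  · exact hasDerivAt_const _ _

theorem sum_mul_wilsonGrad_eq_zero {n : ℕ} {a b c d : ℂ} {xs : Fin n → ℝ}
    (hmin : ∀ y : Fin n → ℝ, W n a b c d xs ≤ W n a b c d y) (u : Fin n → ℝ) :
    ∑ j, u j * wilsonGrad n a b c d xs j = 0 := by
  refine IsLocalMin.hasDerivAt_eq_zero (Filter.Eventually.of_forall fun s => ?_)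
    (hasDerivAt_W_line n a b c d xs u)
  simpa using hmin fun j => xs j + s * u j

/-- Lower bound for the Hessian of `W` on the cube of radius `R`. -/
noncomputable def hessianBound (n : ℕ) (a b c d : ℂ) (R : ℝ) : ℝ :=
  2 * ((n : ℝ) - 1) / (1 + 4 * R ^ 2)
    + a.re / (a.re ^ 2 + (R + |a.im|) ^ 2)
    + b.re / (b.re ^ 2 + (R + |b.im|) ^ 2)
    + c.re / (c.re ^ 2 + (R + |c.im|) ^ 2)
    + d.re / (d.re ^ 2 + (R + |d.im|) ^ 2)

theorem hessianBound_mul_le {n : ℕ} {a b c d : ℂ}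
    (ha : 0 < a.re) (hb : 0 < b.re) (hc : 0 < c.re) (hd : 0 < d.re)
    {x y : Fin n → ℝ} {R : ℝ} (hx : ∀ j, |x j| ≤ R) (hy : ∀ j, |y j| ≤ R) :
    hessianBound n a b c d R * ∑ j, (x j - y j) ^ 2 ≤
      ∑ j, (x j - y j) * wilsonGrad n a b c d x j -
        ∑ j, (x j - y j) * wilsonGrad n a b c d y j := by
  set L := 1 / (1 + (2 * R) ^ 2) with hL
  have hpair : 2 * ((n : ℝ) - 1) / (1 + 4 * R ^ 2) * ∑ j, (x j - y j) ^ 2 =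
      ∑ j, ∑ k, if j < k then
        2 * L * (x j - y j) ^ 2 + 2 * L * (x k - y k) ^ 2 else 0 := by
    rw [sum_lt_add_swap_eq_sum_erase fun j _ => 2 * L * (x j - y j) ^ 2, Finset.mul_sum]
    refine Finset.sum_congr rfl fun j _ => ?_
    have : 1 ≤ n := by have := j.isLt; omega
    rw [Finset.sum_const, Finset.card_erase_of_mem (Finset.mem_univ j), Finset.card_univ,
      Fintype.card_fin, nsmul_eq_mul, Nat.cast_sub this, hL]
    push_cast
    ring
  rw [sum_mul_wilsonGrad, sum_mul_wilsonGrad]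
  unfold hessianBound
  simp only [add_mul]
  rw [hpair, add_sub_add_comm]
  simp only [Finset.mul_sum, add_assoc]
  simp only [← Finset.sum_add_distrib, ← Finset.sum_sub_distrib]
  refine Finset.sum_le_sum fun j _ => ?_
  refine add_le_add (Finset.sum_le_sum fun k _ => ?_) ?_
  · split_ifs
    · have h₁ := mul_sub_arctan_ge (M := 2 * R) (p := x j + x k) (q := y j + y k)
        ((abs_add_le _ _).trans (by linarith [hx j, hx k]))
        ((abs_add_le _ _).trans (by linarith [hy j, hy k]))
      have h₂ := mul_sub_arctan_ge (M := 2 * R) (p := x j - x k) (q := y j - y k)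
        ((abs_sub _ _).trans (by linarith [hx j, hx k]))
        ((abs_sub _ _).trans (by linarith [hy j, hy k]))
      rw [← hL] at h₁ h₂
      linarith
    · simp
  · linarith [mul_sub_gfun_ge ha (hx j) (hy j), mul_sub_gfun_ge hb (hx j) (hy j),
      mul_sub_gfun_ge hc (hx j) (hy j), mul_sub_gfun_ge hd (hx j) (hy j)]

theorem hessianBound_pos {n : ℕ} (hn : 0 < n) {a b c d : ℂ}
    (ha : 0 < a.re) (hb : 0 < b.re) (hc : 0 < c.re) (hd : 0 < d.re) (R : ℝ) :
    0 < hessianBound n a b c d R := by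
  have : (0 : ℝ) ≤ (n : ℝ) - 1 := by
    have : (1 : ℝ) ≤ n := by exact_mod_cast hn
    linarith
  unfold hessianBound
  positivity

theorem continuous_hessianBound {n : ℕ} {a b c d : ℂ}
    (ha : 0 < a.re) (hb : 0 < b.re) (hc : 0 < c.re) (hd : 0 < d.re) :
    Continuous (hessianBound n a b c d) := by
  unfold hessianBound
  have h : ∀ e : ℂ, 0 < e.re →
      Continuous fun R : ℝ => e.re / (e.re ^ 2 + (R + |e.im|) ^ 2) := fun e he =>
    Continuous.div (by fun_prop) (by fun_prop) fun R => by positivity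
  have h₀ : Continuous fun R : ℝ => 2 * ((n : ℝ) - 1) / (1 + 4 * R ^ 2) :=
    Continuous.div (by fun_prop) (by fun_prop) fun R => by positivity
  exact (((h₀.add (h a ha)).add (h b hb)).add (h c hc)).add (h d hd)

theorem le_mul_exp_of_hasDerivWithinAt_le {V V' : ℝ → ℝ} {r T : ℝ}
    (hV : ∀ t, T ≤ t → HasDerivWithinAt V (V' t) (Set.Ici T) t)
    (hle : ∀ t, T ≤ t → V' t ≤ -r * V t) {t : ℝ} (ht : T ≤ t) :
    V t ≤ V T * Real.exp (-r * (t - T)) := by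
  have hexp : ∀ s, HasDerivAt (fun s => Real.exp (r * (s - T))) (Real.exp (r * (s - T)) * r) s := by
    intro s
    simpa using (((hasDerivAt_id s).sub_const T).const_mul r).exp
  have hanti : AntitoneOn (fun s => V s * Real.exp (r * (s - T))) (Set.Ici T) := by
    refine antitoneOn_of_hasDerivWithinAt_nonpos (convex_Ici T)
      (f' := fun s => V' s * Real.exp (r * (s - T)) + V s * (Real.exp (r * (s - T)) * r))
      (fun s hs => ((hV s hs).mul (hexp s).hasDerivWithinAt).continuousWithinAt)
      (fun s hs => ((hV s (interior_subset hs)).mul (hexp s).hasDerivWithinAt).mono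
        interior_subset) ?_
    intro s hs
    have h := hle s (interior_subset hs)
    have := Real.exp_pos (r * (s - T))
    nlinarith
  have h := hanti Set.self_mem_Ici ht ht
  simp only [sub_self, mul_zero, Real.exp_zero, mul_one] at h
  calc V t = V t * Real.exp (r * (t - T)) * Real.exp (-r * (t - T)) := by
        rw [mul_assoc, ← Real.exp_add]; simp
    _ ≤ V T * Real.exp (-r * (t - T)) := by gcongr

/-- exponential convergence of the Wilson gradient flow
`dx_j/dt = −∂W/∂x_j`, i.e.
`dx_j/dt − πj + g_a(x_j)+g_b(x_j)+g_c(x_j)+g_d(x_j)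
  + Σ_{k≠j}(arctan(x_j+x_k)+arctan(x_j−x_k)) = 0`,
to the unique global minimizer `x*` of `W` (with `0 < x₁* < ⋯ < xₙ*` and `Rₙ = xₙ*`):
for any `0 < κ < 2(n−1)/(1+4Rₙ²) + Σ_{ε∈{a,b,c,d}} Re ε/(Re²ε + (Rₙ+|Im ε|)²)` there is
`K > 0` with `|x_j(t) − x_j*| ≤ K e^{−κt}` for all `j` and `t ≥ 0`. -/
theorem wilson_gradient_flow_exponential_convergence
    (n : ℕ) (hn : 0 < n) (a b c d : ℂ)
    (ha : 0 < a.re) (hb : 0 < b.re) (hc : 0 < c.re) (hd : 0 < d.re)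
    (habcd : QuadCond a b c d)
    (xs : Fin n → ℝ) (hmin : ∀ y : Fin n → ℝ, W n a b c d xs ≤ W n a b c d y)
    (hpos : ∀ j : Fin n, 0 < xs j) (hmono : StrictMono xs)
    (x : ℝ → Fin n → ℝ)
    (hode : ∀ t ∈ Set.Ici (0 : ℝ), ∀ j : Fin n,
      HasDerivWithinAt (fun s => x s j)
        (-(-(Real.pi * (((j : ℕ) : ℝ) + 1))
            + gfun a (x t j) + gfun b (x t j) + gfun c (x t j) + gfun d (x t j)
            + ∑ k ∈ Finset.univ.erase j,
                (Real.arctan (x t j + x t k) + Real.arctan (x t j - x t k))))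
        (Set.Ici (0 : ℝ)) t)
    (κ : ℝ) (hκ0 : 0 < κ)
    (hκ : κ < 2 * ((n : ℝ) - 1) / (1 + 4 * (xs ⟨n - 1, by omega⟩) ^ 2)
             + a.re / (a.re ^ 2 + (xs ⟨n - 1, by omega⟩ + |a.im|) ^ 2)
             + b.re / (b.re ^ 2 + (xs ⟨n - 1, by omega⟩ + |b.im|) ^ 2)
             + c.re / (c.re ^ 2 + (xs ⟨n - 1, by omega⟩ + |c.im|) ^ 2)
             + d.re / (d.re ^ 2 + (xs ⟨n - 1, by omega⟩ + |d.im|) ^ 2)) :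
    ∃ K > (0 : ℝ), ∀ j : Fin n, ∀ t ∈ Set.Ici (0 : ℝ),
      |x t j - xs j| ≤ K * Real.exp (-κ * t) := by
  set R := xs ⟨n - 1, by omega⟩
  have hxsR : ∀ j, |xs j| ≤ R := fun j => by
    rw [abs_of_pos (hpos j)]
    exact hmono.monotone (Fin.mk_le_mk.mpr (by have := j.isLt; omega))
  set V : ℝ → ℝ := fun t => ∑ j, (x t j - xs j) ^ 2 with hVdef
  set V' : ℝ → ℝ := fun t => -2 * ∑ j, (x t j - xs j) * wilsonGrad n a b c d (x t) j with hV'def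
  have hVnonneg : ∀ t, 0 ≤ V t := fun t => Finset.sum_nonneg fun j _ => sq_nonneg _
  have hcoord : ∀ t j, (x t j - xs j) ^ 2 ≤ V t := fun t j =>
    Finset.single_le_sum (f := fun j => (x t j - xs j) ^ 2) (fun j _ => sq_nonneg _)
      (Finset.mem_univ j)
  have hderiv : ∀ T, 0 ≤ T → ∀ t, T ≤ t → HasDerivWithinAt V (V' t) (Set.Ici T) t := by
    intro T hT t ht
    have h : HasDerivWithinAt V
        (∑ j, 2 * (x t j - xs j) * -wilsonGrad n a b c d (x t) j) (Set.Ici 0) t := by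
      refine HasDerivWithinAt.fun_sum fun j _ => ?_
      simpa [wilsonGrad] using ((hode t (hT.trans ht) j).sub_const (xs j)).fun_pow 2
    refine (h.congr_deriv ?_).mono (Set.Ici_subset_Ici.mpr hT)
    simp only [hV'def, Finset.mul_sum]
    exact Finset.sum_congr rfl fun j _ => by ring
  have hdecay : ∀ δ, 0 ≤ δ → ∀ t, V t ≤ δ ^ 2 →
      V' t ≤ -(2 * hessianBound n a b c d (R + δ)) * V t := by
    intro δ hδ t hVt
    have hclose : ∀ j, |x t j - xs j| ≤ δ := fun j =>
      abs_le_of_sq_le_sq ((hcoord t j).trans hVt) hδ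
    have h := hessianBound_mul_le ha hb hc hd (x := x t) (y := xs) (R := R + δ)
      (fun j => by
        calc |x t j| = |xs j + (x t j - xs j)| := by ring_nf
          _ ≤ _ := (abs_add_le _ _).trans (add_le_add (hxsR j) (hclose j)))
      (fun j => (hxsR j).trans (by linarith))
    rw [sum_mul_wilsonGrad_eq_zero hmin, sub_zero] at h
    simp only [hV'def, hVdef]
    linarith
  have hpos' := fun δ => hessianBound_pos hn ha hb hc hd (R + δ)
  have hanti : ∀ T, 0 ≤ T → ∀ t, T ≤ t → V t ≤ V T := by
    intro T hT t ht
    have h := le_mul_exp_of_hasDerivWithinAt_le (r := 0) (hderiv T hT) (fun s _ => by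
      have := hdecay (√(V s)) (Real.sqrt_nonneg _) s (Real.sq_sqrt (hVnonneg s)).ge
      nlinarith [mul_nonneg (hpos' √(V s)).le (hVnonneg s)]) ht
    simpa using h
  obtain ⟨δ, hδpos, hδ⟩ : ∃ δ > 0, κ < hessianBound n a b c d (R + δ) := by
    have h0 : κ < hessianBound n a b c d R := by simpa [hessianBound] using hκ
    have hev := (continuous_hessianBound (n := n) ha hb hc hd).continuousAt.eventually
      (lt_mem_nhds h0)
    obtain ⟨ε, hε, hball⟩ := Metric.eventually_nhds_iff.mp hev
    exact ⟨ε / 2, by positivity, hball (by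
      rw [Real.dist_eq, add_sub_cancel_left, abs_of_pos (by positivity)]; linarith)⟩
  obtain ⟨T, hT, hVT⟩ : ∃ T, 0 ≤ T ∧ V T ≤ δ ^ 2 := by
    set r := 2 * hessianBound n a b c d (R + √(V 0))
    have hrpos : 0 < r := by have := hpos' √(V 0); positivity
    have hbound : ∀ t, 0 ≤ t → V t ≤ V 0 * Real.exp (-r * t) := fun t ht => by
      simpa using le_mul_exp_of_hasDerivWithinAt_le (hderiv 0 le_rfl)
        (fun s hs => hdecay √(V 0) (Real.sqrt_nonneg _) s
          ((hanti 0 le_rfl s hs).trans (Real.sq_sqrt (hVnonneg 0)).ge)) ht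
    have htend : Filter.Tendsto (fun t => V 0 * Real.exp (-r * t)) Filter.atTop (nhds 0) := by
      have h := Real.tendsto_exp_atBot.comp
        (Filter.tendsto_id.const_mul_atTop_of_neg (neg_lt_zero.mpr hrpos))
      simpa using h.const_mul (V 0)
    obtain ⟨T, hTδ, hT⟩ := ((htend.eventually (gt_mem_nhds (pow_pos hδpos 2))).and
      (Filter.eventually_ge_atTop 0)).exists
    exact ⟨T, hT, (hbound T hT).trans hTδ.le⟩
  have hfinal : ∀ t, 0 ≤ t → V t ≤ V 0 * Real.exp (-(2 * κ) * (t - T)) := by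
    intro t ht
    rcases le_total T t with h | h
    · refine (le_mul_exp_of_hasDerivWithinAt_le (r := 2 * κ) (hderiv T hT) (fun s hs => ?_) h).trans ?_
      · have := hdecay δ hδpos.le s ((hanti T hT s hs).trans hVT)
        nlinarith [hVnonneg s]
      · gcongr
        exact hanti 0 le_rfl T hT
    · refine (hanti 0 le_rfl t ht).trans (le_mul_of_one_le_right (hVnonneg 0) ?_)
      exact Real.one_le_exp (by nlinarith)
  refine ⟨(√(V 0) + 1) * Real.exp (κ * T), by positivity, fun j t ht => ?_⟩
  refine abs_le_of_sq_le_sq ?_ (by positivity)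
  calc (x t j - xs j) ^ 2 ≤ V 0 * Real.exp (-(2 * κ) * (t - T)) :=
        (hcoord t j).trans (hfinal t ht)
    _ ≤ (√(V 0) + 1) ^ 2 * Real.exp (-(2 * κ) * (t - T)) := by
        gcongr
        nlinarith [Real.sq_sqrt (hVnonneg 0), Real.sqrt_nonneg (V 0)]
    _ = ((√(V 0) + 1) * Real.exp (κ * T) * Real.exp (-κ * t)) ^ 2 := by
        rw [mul_assoc, mul_pow, ← Real.exp_add, ← Real.exp_nat_mul]
        push_cast
        ring_nf
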